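/- (Existence for monotone nonlinear FBSΔE via continuation.) Under the Lipschitz and monotone conditions of Assumption on (b, σ, f, h) (with constants c₁, c₂ > 0), the fully coupled FBSΔE ΔX_t = b(t,X_t,Y_t,Z_tĨ) + σ(t,X_t,Y_t,Z_tĨ)M_{t+1}, ΔY_t = -f(t+1,X_{t+1},Y_{t+1},Z_{t+1}Ĩ) + Z_t M_{t+1}, X_0 = x_0, Y_T = h(X_T) admits an adapted solution (X,Y,Z) ∈ M(0,T;R) × M(0,T;R) × M(0,T-1;R^{1×N}). -/

import Mathlib

open Finset Matrix

section Setup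

variable {Ω : Type*} [Fintype Ω] [DecidableEq Ω] {N : ℕ}

/-- A probability on a finite sample space with everywhere-positive weights. -/
structure FinProb (Ω : Type*) [Fintype Ω] where
  p : Ω → ℝ
  pos : ∀ ω, 0 < p ω
  sum_one : ∑ ω, p ω = 1

/-- `ω` and `ω'` share the same `W`-path up to time `t` (the atoms of `F_t`). -/
def samePath (W : ℕ → Ω → Fin N) (t : ℕ) (ω ω' : Ω) : Prop :=
  ∀ s ∈ Finset.range (t + 1), W s ω = W s ω'

instance (W : ℕ → Ω → Fin N) (t : ℕ) (ω ω' : Ω) : Decidable (samePath W t ω ω') := by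
  unfold samePath; infer_instance

/-- `F_t`-measurability: `f` is constant on the atoms of `F_t`. -/
def measF (W : ℕ → Ω → Fin N) (t : ℕ) {α : Type*} (f : Ω → α) : Prop :=
  ∀ ω ω', samePath W t ω ω' → f ω = f ω'

/-- Conditional expectation given `F_t`. -/
noncomputable def cexp (P : FinProb Ω) (W : ℕ → Ω → Fin N) (t : ℕ)
    {E : Type*} [AddCommGroup E] [Module ℝ E] (Y : Ω → E) (ω : Ω) : E :=
  (∑ ω' ∈ univ.filter (fun ω' => samePath W t ω ω'), P.p ω')⁻¹ •
    ∑ ω' ∈ univ.filter (fun ω' => samePath W t ω ω'), P.p ω' • Y ω'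

/-- The basis-vector valued process `W_t ∈ {e_1,…,e_N} ⊆ ℝ^N`. -/
def wvec (W : ℕ → Ω → Fin N) (t : ℕ) (ω : Ω) : Fin N → ℝ :=
  fun j => if W t ω = j then 1 else 0

/-- `M_{t+1} = W_{t+1} - E[W_{t+1} | F_t]` (indexed so that `Mdiff P W t` is `M_{t+1}`). -/
noncomputable def Mdiff (P : FinProb Ω) (W : ℕ → Ω → Fin N) (t : ℕ) (ω : Ω) : Fin N → ℝ :=
  wvec W (t + 1) ω - cexp P W t (wvec W (t + 1)) ω

/-- One-step conditional transition probability `P_t^k = e_k^* E[W_{t+1}|F_t]`. -/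
noncomputable def Pt (P : FinProb Ω) (W : ℕ → Ω → Fin N) (t : ℕ) (k : Fin N) (ω : Ω) : ℝ :=
  cexp P W t (fun ω' => wvec W (t + 1) ω' k) ω

/-- The `N × (N-1)` matrix `Ĩ` whose top block is the identity and last row is all `-1`. -/
def Itil (n : ℕ) : Matrix (Fin (n + 1)) (Fin n) ℝ :=
  fun i j => if (i : ℕ) = (j : ℕ) then 1 else if (i : ℕ) = n then -1 else 0

end Setup


section NonlinearDefs

variable {Ω : Type*} [Fintype Ω] [DecidableEq Ω]

/-- `E[M_{t+1} M_{t+1}^* | F_t]`. -/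
noncomputable def EMM {n : ℕ} (P : FinProb Ω) (W : ℕ → Ω → Fin (n + 1)) (t : ℕ) (ω : Ω) :
    Matrix (Fin (n + 1)) (Fin (n + 1)) ℝ :=
  cexp P W t (fun ω' => Matrix.of fun i j => Mdiff P W t ω' i * Mdiff P W t ω' j) ω

/-- Euclidean norm of a finite real vector. -/
noncomputable def nr {m : ℕ} (v : Fin m → ℝ) : ℝ := Real.sqrt (∑ j, v j ^ 2)

/-- the row vector `z Ĩ`. -/
def zItil {n : ℕ} (z : Fin (n + 1) → ℝ) : Fin n → ℝ := Matrix.vecMul z (Itil n)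

end NonlinearDefs

section Helpers

/-- zero of a strongly monotone Lipschitz map -/
lemma exists_zero_of_strongMono {H : Type*} [NormedAddCommGroup H] [InnerProductSpace ℝ H]
    [CompleteSpace H] (F : H → H) (L c : ℝ) (hc : 0 < c)
    (hL : ∀ u v, ‖F u - F v‖ ≤ L * ‖u - v‖)
    (hm : ∀ u v, c * ‖u - v‖ ^ 2 ≤ inner ℝ (F u - F v) (u - v)) : ∃ u, F u = 0 := by
  set L' : ℝ := |L| + c with hL'
  have hL'pos : 0 < L' := by positivity
  have hcL : c ≤ L' := by rw [hL']; linarith [abs_nonneg L]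
  have hL2 : ∀ u v, ‖F u - F v‖ ≤ L' * ‖u - v‖ := fun u v =>
    (hL u v).trans (mul_le_mul_of_nonneg_right (by rw [hL']; linarith [le_abs_self L])
      (norm_nonneg _))
  set ε : ℝ := c / L' ^ 2 with hε
  have hεpos : 0 < ε := by positivity
  set q : ℝ := 1 - c ^ 2 / L' ^ 2 with hq
  have hq0 : 0 ≤ q := by
    rw [hq, sub_nonneg, div_le_one (by positivity)]
    gcongr
  have hq1 : q < 1 := by
    have : 0 < c ^ 2 / L' ^ 2 := by positivity
    linarith
  have hkey : ∀ u v, ‖(u - ε • F u) - (v - ε • F v)‖ ≤ Real.sqrt q * ‖u - v‖ := by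
    intro u v
    have h1 : (u - ε • F u) - (v - ε • F v) = (u - v) - ε • (F u - F v) := by
      rw [smul_sub]; abel
    rw [h1]
    have h2 : ‖(u - v) - ε • (F u - F v)‖ ^ 2 ≤ (Real.sqrt q * ‖u - v‖) ^ 2 := by
      rw [norm_sub_sq_real, mul_pow, Real.sq_sqrt hq0, norm_smul, real_inner_smul_right,
        real_inner_comm, mul_pow, Real.norm_eq_abs, sq_abs]
      have h3 := hm u v
      have h4 : ‖F u - F v‖ ^ 2 ≤ (L' * ‖u - v‖) ^ 2 :=
        pow_le_pow_left₀ (norm_nonneg _) (hL2 u v) 2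
      have h5 : ε * L' ^ 2 = c := by rw [hε]; field_simp
      have h6 : q = 1 - ε * c := by rw [hq, hε]; ring
      have h7 := mul_le_mul_of_nonneg_left h3 hεpos.le
      have h8 := mul_le_mul_of_nonneg_left h4 (sq_nonneg ε)
      have h9 : ε ^ 2 * (L' * ‖u - v‖) ^ 2 = ε * c * ‖u - v‖ ^ 2 := by
        rw [← h5]; ring
      rw [h6]
      nlinarith
    exact le_of_sq_le_sq h2 (by positivity)
  have hcontr : ContractingWith (Real.toNNReal (Real.sqrt q)) (fun u => u - ε • F u) := by
    constructor
    · rw [← NNReal.coe_lt_coe, Real.coe_toNNReal _ (Real.sqrt_nonneg _)]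
      have := Real.sqrt_lt_sqrt hq0 hq1
      simpa using this
    · apply LipschitzWith.of_dist_le_mul
      intro u v
      rw [dist_eq_norm, dist_eq_norm, Real.coe_toNNReal _ (Real.sqrt_nonneg _)]
      exact hkey u v
  refine ⟨ContractingWith.fixedPoint _ hcontr, ?_⟩
  have h := hcontr.fixedPoint_isFixedPt
  have h' : ε • F (ContractingWith.fixedPoint _ hcontr) = 0 := by
    have h2 := h.eq
    simpa using h2
  exact (smul_eq_zero.mp h').resolve_left (ne_of_gt hεpos)

/-- variational version on a subspace -/
lemma exists_variational {ι : Type*} [Fintype ι] (S : Submodule ℝ (EuclideanSpace ℝ ι))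
    (F : EuclideanSpace ℝ ι → ι → ℝ) (c : ℝ) (hc : 0 < c)
    (hL : ∀ i, ∃ K, ∀ u v, |F u i - F v i| ≤ K * ‖u - v‖)
    (hm : ∀ u ∈ S, ∀ v ∈ S, c * ∑ i, (u i - v i) ^ 2 ≤ ∑ i, (F u i - F v i) * (u i - v i)) :
    ∃ u ∈ S, ∀ v ∈ S, ∑ i, F u i * v i = 0 := by
  choose K hK using hL
  let F1 : EuclideanSpace ℝ ι → EuclideanSpace ℝ ι := fun u => WithLp.toLp 2 (F u)
  let F2 : S → S := fun u => S.orthogonalProjectionOnto (F1 u)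
  have hin : ∀ x y : EuclideanSpace ℝ ι, inner ℝ x y = ∑ i, x i * y i := by
    intro x y
    simp [PiLp.inner_apply, mul_comm]
  have hF2 : ∀ u v w : S, inner ℝ (F2 u - F2 v) w = ∑ i, (F u i - F v i) * (w : EuclideanSpace ℝ ι) i := by
    intro u v w
    have : F2 u - F2 v = S.orthogonalProjectionOnto (F1 u - F1 v) := by simp [F2]
    rw [this, Submodule.inner_orthogonalProjectionOnto_eq_of_mem_right, hin]
    rfl
  have hL1 : ∀ u v, ‖F1 u - F1 v‖ ≤ (∑ i, |K i|) * ‖u - v‖ := by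
    intro u v
    rw [EuclideanSpace.norm_eq]
    have h1 : ∑ i, ‖(F1 u - F1 v) i‖ ^ 2 ≤ (∑ i, ‖(F1 u - F1 v) i‖) ^ 2 :=
      Finset.sum_sq_le_sq_sum_of_nonneg (fun i _ => norm_nonneg _)
    calc _ ≤ Real.sqrt ((∑ i, ‖(F1 u - F1 v) i‖) ^ 2) := Real.sqrt_le_sqrt h1
      _ = ∑ i, ‖(F1 u - F1 v) i‖ := Real.sqrt_sq (Finset.sum_nonneg fun i _ => norm_nonneg _)
      _ ≤ ∑ i, |K i| * ‖u - v‖ := Finset.sum_le_sum fun i _ =>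
          (hK i u v).trans (mul_le_mul_of_nonneg_right (le_abs_self _) (norm_nonneg _))
      _ = _ := by rw [Finset.sum_mul]
  obtain ⟨u, hu⟩ := exists_zero_of_strongMono F2 (∑ i, |K i|) c hc
    (by
      intro u v
      have : F2 u - F2 v = S.orthogonalProjectionOnto (F1 u - F1 v) := by simp [F2]
      rw [this]
      exact (S.norm_orthogonalProjectionOnto_apply_le _).trans (hL1 u v))
    (by
      intro u v
      rw [hF2]
      have := hm u u.2 v v.2
      have e : ‖u - v‖ ^ 2 = ∑ i, ((u : EuclideanSpace ℝ ι) i - (v : EuclideanSpace ℝ ι) i) ^ 2 := by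
        rw [Submodule.coe_norm, EuclideanSpace.norm_sq_eq]
        simp
      rw [e]
      simpa using this)
  refine ⟨u, u.2, fun v hv => ?_⟩
  have h1 : inner ℝ (F2 u) (⟨v, hv⟩ : S) = 0 := by rw [hu]; simp
  rw [Submodule.inner_orthogonalProjectionOnto_eq_of_mem_right, hin] at h1
  exact h1

lemma nr_le_sum {m : ℕ} (v : Fin m → ℝ) : nr v ≤ ∑ j, |v j| := by
  unfold nr
  have h1 : ∑ j, v j ^ 2 ≤ (∑ j, |v j|) ^ 2 := by
    simpa using Finset.sum_sq_le_sq_sum_of_nonneg (s := Finset.univ) (f := fun j => |v j|)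
      (fun i _ => abs_nonneg _)
  exact (Real.sqrt_le_sqrt h1).trans
    (Real.sqrt_sq (Finset.sum_nonneg fun i _ => abs_nonneg _)).le

lemma abs_le_nr {m : ℕ} (v : Fin m → ℝ) (j : Fin m) : |v j| ≤ nr v := by
  unfold nr
  apply Real.abs_le_sqrt
  exact Finset.single_le_sum (f := fun j => v j ^ 2) (fun i _ => sq_nonneg _) (Finset.mem_univ j)

lemma nr_nonneg {m : ℕ} (v : Fin m → ℝ) : 0 ≤ nr v := Real.sqrt_nonneg _

lemma nr_sq {m : ℕ} (v : Fin m → ℝ) : nr v ^ 2 = ∑ j, v j ^ 2 :=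
  Real.sq_sqrt (Finset.sum_nonneg fun i _ => sq_nonneg _)

/-- real-valued Lipschitz functions -/
def IsLip {E : Type*} [NormedAddCommGroup E] (g : E → ℝ) : Prop :=
  ∃ K, ∀ u v, |g u - g v| ≤ K * ‖u - v‖

namespace IsLip
variable {E : Type*} [NormedAddCommGroup E]

lemma const (c : ℝ) : IsLip (fun _ : E => c) := ⟨0, by simp⟩

lemma add {g k : E → ℝ} (hg : IsLip g) (hk : IsLip k) : IsLip (fun u => g u + k u) := by
  obtain ⟨K, hK⟩ := hg
  obtain ⟨K', hK'⟩ := hk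
  refine ⟨K + K', fun u v => ?_⟩
  have h1 := hK u v
  have h2 := hK' u v
  have : g u + k u - (g v + k v) = (g u - g v) + (k u - k v) := by ring
  rw [this]
  linarith [abs_add_le (g u - g v) (k u - k v)]

lemma cmul {g : E → ℝ} (c : ℝ) (hg : IsLip g) : IsLip (fun u => c * g u) := by
  obtain ⟨K, hK⟩ := hg
  refine ⟨|c| * K, fun u v => ?_⟩
  rw [← mul_sub, abs_mul, mul_assoc]
  exact mul_le_mul_of_nonneg_left (hK u v) (abs_nonneg _)

lemma neg {g : E → ℝ} (hg : IsLip g) : IsLip (fun u => - g u) := by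
  simpa using hg.cmul (-1)

lemma sub {g k : E → ℝ} (hg : IsLip g) (hk : IsLip k) : IsLip (fun u => g u - k u) := by
  simpa [sub_eq_add_neg] using hg.add hk.neg

lemma sum {α : Type*} (s : Finset α) {g : α → E → ℝ} (hg : ∀ i ∈ s, IsLip (g i)) :
    IsLip (fun u => ∑ i ∈ s, g i u) := by
  classical
  induction s using Finset.induction_on with
  | empty => simpa using const (E := E) 0
  | insert a s ha ih =>
    simp only [Finset.sum_insert ha]
    exact (hg a (by simp)).add (ih fun i hi => hg i (by simp [hi]))

lemma abs_nonneg_const {g : E → ℝ} (hg : IsLip g) :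
    ∃ K, 0 ≤ K ∧ ∀ u v, |g u - g v| ≤ K * ‖u - v‖ := by
  obtain ⟨K, hK⟩ := hg
  exact ⟨|K|, abs_nonneg _, fun u v =>
    (hK u v).trans (mul_le_mul_of_nonneg_right (le_abs_self _) (norm_nonneg _))⟩

lemma comp3 {n : ℕ} {B : ℝ → ℝ → (Fin n → ℝ) → ℝ} {C : ℝ} (hC : 0 ≤ C)
    (hB : ∀ x y zi x' y' zi', |B x y zi - B x' y' zi'| ≤
      C * (|x - x'| + |y - y'| + nr (zi - zi')))
    {x y : E → ℝ} {z : E → Fin n → ℝ} (hx : IsLip x) (hy : IsLip y)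
    (hz : ∀ j, IsLip (fun u => z u j)) : IsLip (fun u => B (x u) (y u) (z u)) := by
  obtain ⟨K1, h1⟩ := hx
  obtain ⟨K2, h2⟩ := hy
  choose K3 h3 using hz
  refine ⟨C * (K1 + K2 + ∑ j, K3 j), fun u v => (hB _ _ _ _ _ _).trans ?_⟩
  rw [mul_assoc]
  apply mul_le_mul_of_nonneg_left _ hC
  have h4 : nr (z u - z v) ≤ (∑ j, K3 j) * ‖u - v‖ := by
    refine (nr_le_sum _).trans ?_
    rw [Finset.sum_mul]
    exact Finset.sum_le_sum fun j _ => h3 j u v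
  rw [add_mul, add_mul]
  linarith [h1 u v, h2 u v]

end IsLip

end Helpers

section ProbHelpers

variable {Ω : Type*} [Fintype Ω] [DecidableEq Ω] {n : ℕ}

lemma samePath_refl (W : ℕ → Ω → Fin (n + 1)) (t : ℕ) (ω : Ω) : samePath W t ω ω :=
  fun _ _ => rfl

lemma samePath_symm {W : ℕ → Ω → Fin (n + 1)} {t : ℕ} {ω ω' : Ω} (h : samePath W t ω ω') :
    samePath W t ω' ω := fun s hs => (h s hs).symm

lemma samePath_trans {W : ℕ → Ω → Fin (n + 1)} {t : ℕ} {ω ω' ω'' : Ω} (h : samePath W t ω ω')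
    (h' : samePath W t ω' ω'') : samePath W t ω ω'' := fun s hs => (h s hs).trans (h' s hs)

lemma samePath_mono {W : ℕ → Ω → Fin (n + 1)} {t : ℕ} {ω ω' : Ω}
    (h : samePath W (t + 1) ω ω') : samePath W t ω ω' := fun s hs =>
  h s (by simp at hs ⊢; omega)

lemma samePath_succ {W : ℕ → Ω → Fin (n + 1)} {t : ℕ} {ω ω' : Ω}
    (h : samePath W t ω ω') (h' : W (t + 1) ω = W (t + 1) ω') : samePath W (t + 1) ω ω' := by
  intro s hs
  by_cases hst : s = t + 1
  · rw [hst]; exact h'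
  · exact h s (by simp at hs ⊢; omega)

/-- the atom of `ω` -/
def atomF (W : ℕ → Ω → Fin (n + 1)) (t : ℕ) (ω : Ω) : Finset Ω :=
  univ.filter (fun ω' => samePath W t ω ω')

lemma mem_atomF {W : ℕ → Ω → Fin (n + 1)} {t : ℕ} {ω ω' : Ω} :
    ω' ∈ atomF W t ω ↔ samePath W t ω ω' := by simp [atomF]

lemma atomF_eq {W : ℕ → Ω → Fin (n + 1)} {t : ℕ} {ω ω' : Ω} (h : samePath W t ω ω') :
    atomF W t ω = atomF W t ω' := by
  ext x
  simp only [mem_atomF]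
  exact ⟨fun h1 => samePath_trans (samePath_symm h) h1, fun h1 => samePath_trans h h1⟩

lemma cexp_real (P : FinProb Ω) (W : ℕ → Ω → Fin (n + 1)) (t : ℕ) (Y : Ω → ℝ) (ω : Ω) :
    cexp P W t Y ω = (∑ ω' ∈ atomF W t ω, P.p ω')⁻¹ * ∑ ω' ∈ atomF W t ω, P.p ω' * Y ω' := rfl

lemma atom_pos (P : FinProb Ω) (W : ℕ → Ω → Fin (n + 1)) (t : ℕ) (ω : Ω) :
    0 < ∑ ω' ∈ atomF W t ω, P.p ω' :=
  Finset.sum_pos (fun i _ => P.pos i) ⟨ω, mem_atomF.2 (samePath_refl W t ω)⟩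

lemma cexp_measF (P : FinProb Ω) (W : ℕ → Ω → Fin (n + 1)) (t : ℕ) (Y : Ω → ℝ) :
    measF W t (cexp P W t Y) := by
  intro ω ω' h
  rw [cexp_real, cexp_real, atomF_eq h]

lemma measF_succ {W : ℕ → Ω → Fin (n + 1)} {t : ℕ} {α : Type*} {g : Ω → α} (h : measF W t g) :
    measF W (t + 1) g := fun ω ω' hh => h ω ω' (samePath_mono hh)

lemma cexp_mul (P : FinProb Ω) (W : ℕ → Ω → Fin (n + 1)) (t : ℕ) (g Y : Ω → ℝ)
    (hg : measF W t g) (ω : Ω) :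
    cexp P W t (fun ω => g ω * Y ω) ω = g ω * cexp P W t Y ω := by
  rw [cexp_real, cexp_real, mul_left_comm]
  congr 1
  rw [Finset.mul_sum]
  refine Finset.sum_congr rfl fun x hx => ?_
  rw [hg ω x (mem_atomF.1 hx)]; ring

lemma cexp_congr (P : FinProb Ω) (W : ℕ → Ω → Fin (n + 1)) (t : ℕ) (g Y : Ω → ℝ) (ω : Ω)
    (h : ∀ ω', samePath W t ω ω' → g ω' = Y ω') : cexp P W t g ω = cexp P W t Y ω := by
  rw [cexp_real, cexp_real]
  congr 1
  refine Finset.sum_congr rfl fun x hx => ?_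
  rw [h x (mem_atomF.1 hx)]

lemma cexp_const (P : FinProb Ω) (W : ℕ → Ω → Fin (n + 1)) (t : ℕ) (c : ℝ) (ω : Ω) :
    cexp P W t (fun _ => c) ω = c := by
  rw [cexp_real, ← Finset.sum_mul, ← mul_assoc, inv_mul_cancel₀ (atom_pos P W t ω).ne', one_mul]

lemma cexp_add (P : FinProb Ω) (W : ℕ → Ω → Fin (n + 1)) (t : ℕ) (g k : Ω → ℝ) (ω : Ω) :
    cexp P W t (fun ω => g ω + k ω) ω = cexp P W t g ω + cexp P W t k ω := by
  simp only [cexp_real, mul_add, Finset.sum_add_distrib]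

lemma cexp_sub (P : FinProb Ω) (W : ℕ → Ω → Fin (n + 1)) (t : ℕ) (g k : Ω → ℝ) (ω : Ω) :
    cexp P W t (fun ω => g ω - k ω) ω = cexp P W t g ω - cexp P W t k ω := by
  simp only [cexp_real, mul_sub, Finset.sum_sub_distrib]

lemma cexp_sum (P : FinProb Ω) (W : ℕ → Ω → Fin (n + 1)) (t : ℕ) {α : Type*} (s : Finset α)
    (g : α → Ω → ℝ) (ω : Ω) :
    cexp P W t (fun ω => ∑ i ∈ s, g i ω) ω = ∑ i ∈ s, cexp P W t (g i) ω := by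
  simp only [cexp_real, Finset.mul_sum]
  rw [Finset.sum_comm]

/-- tower property -/
lemma sum_cexp (P : FinProb Ω) (W : ℕ → Ω → Fin (n + 1)) (t : ℕ) (Y : Ω → ℝ) :
    ∑ ω, P.p ω * cexp P W t Y ω = ∑ ω, P.p ω * Y ω := by
  have h1 : ∀ ω, P.p ω * cexp P W t Y ω = ∑ ω', if samePath W t ω ω' then
      P.p ω * (∑ x ∈ atomF W t ω', P.p x)⁻¹ * (P.p ω' * Y ω') else 0 := by
    intro ω
    rw [cexp_real, ← Finset.sum_filter, ← mul_assoc, Finset.mul_sum]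
    refine Finset.sum_congr rfl fun x hx => ?_
    rw [atomF_eq (mem_atomF.1 hx)]
  simp_rw [h1]
  rw [Finset.sum_comm]
  refine Finset.sum_congr rfl fun ω' _ => ?_
  have h2 : ∀ ω, (if samePath W t ω ω' then
      P.p ω * (∑ x ∈ atomF W t ω', P.p x)⁻¹ * (P.p ω' * Y ω') else 0) =
      (if samePath W t ω' ω then
      P.p ω * (∑ x ∈ atomF W t ω', P.p x)⁻¹ * (P.p ω' * Y ω') else 0) := by
    intro ω
    by_cases h : samePath W t ω ω'
    · rw [if_pos h, if_pos (samePath_symm h)]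
    · rw [if_neg h, if_neg (fun h' => h (samePath_symm h'))]
  simp_rw [h2]
  rw [← Finset.sum_filter, ← Finset.sum_mul, ← Finset.sum_mul]
  change (∑ x ∈ atomF W t ω', P.p x) * _ * _ = _
  rw [mul_inv_cancel₀ (atom_pos P W t ω').ne', one_mul]

lemma sum_mul_cexp (P : FinProb Ω) (W : ℕ → Ω → Fin (n + 1)) (t : ℕ) (g Y : Ω → ℝ)
    (hg : measF W t g) :
    ∑ ω, P.p ω * (g ω * Y ω) = ∑ ω, P.p ω * (g ω * cexp P W t Y ω) := by
  rw [← sum_cexp P W t (fun ω => g ω * Y ω)]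
  refine Finset.sum_congr rfl fun ω _ => ?_
  rw [cexp_mul P W t g Y hg]

lemma cexp_wvec_apply (P : FinProb Ω) (W : ℕ → Ω → Fin (n + 1)) (t : ℕ) (ω : Ω) (k : Fin (n + 1)) :
    cexp P W t (wvec W (t + 1)) ω k = Pt P W t k ω := by
  unfold Pt cexp
  simp [Finset.sum_apply]

lemma Mdiff_apply (P : FinProb Ω) (W : ℕ → Ω → Fin (n + 1)) (t : ℕ) (ω : Ω) (k : Fin (n + 1)) :
    Mdiff P W t ω k = wvec W (t + 1) ω k - Pt P W t k ω := by
  simp [Mdiff, cexp_wvec_apply]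

lemma Pt_measF (P : FinProb Ω) (W : ℕ → Ω → Fin (n + 1)) (t : ℕ) (k : Fin (n + 1)) :
    measF W t (Pt P W t k) := cexp_measF P W t _

lemma sum_wvec (W : ℕ → Ω → Fin (n + 1)) (t : ℕ) (ω : Ω) (s : Fin (n + 1) → ℝ) :
    ∑ k, s k * wvec W t ω k = s (W t ω) := by
  simp [wvec]

lemma sum_Pt (P : FinProb Ω) (W : ℕ → Ω → Fin (n + 1)) (t : ℕ) (ω : Ω) :
    ∑ k, Pt P W t k ω = 1 := by
  unfold Pt
  rw [← cexp_sum]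
  have : (fun ω => ∑ i, wvec W (t + 1) ω i) = fun _ => (1 : ℝ) := by
    funext ω; simp [wvec]
  rw [this, cexp_const]

lemma dot_Mdiff (P : FinProb Ω) (W : ℕ → Ω → Fin (n + 1)) (t : ℕ) (ω : Ω) (s : Fin (n + 1) → ℝ) :
    dotProduct s (Mdiff P W t ω) = s (W (t + 1) ω) - ∑ k, s k * Pt P W t k ω := by
  simp only [dotProduct, Mdiff_apply, mul_sub, Finset.sum_sub_distrib, sum_wvec]

lemma EMM_apply (P : FinProb Ω) (W : ℕ → Ω → Fin (n + 1)) (t : ℕ) (ω : Ω) (i j : Fin (n + 1)) :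
    EMM P W t ω i j = (if i = j then Pt P W t j ω else 0) - Pt P W t i ω * Pt P W t j ω := by
  have h0 : EMM P W t ω i j = cexp P W t (fun ω' => Mdiff P W t ω' i * Mdiff P W t ω' j) ω := by
    unfold EMM cexp
    simp [Matrix.smul_apply, Matrix.sum_apply]
  rw [h0]
  have h1 : cexp P W t (fun ω' => Mdiff P W t ω' i * Mdiff P W t ω' j) ω =
      cexp P W t (fun ω' => ((if i = j then 1 else 0) * wvec W (t + 1) ω' j -
        Pt P W t i ω * wvec W (t + 1) ω' j) - (Pt P W t j ω * wvec W (t + 1) ω' i -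
        Pt P W t i ω * Pt P W t j ω)) ω := by
    apply cexp_congr
    intro ω' h
    rw [Mdiff_apply, Mdiff_apply, ← Pt_measF P W t i ω ω' h, ← Pt_measF P W t j ω ω' h]
    have : wvec W (t + 1) ω' i * wvec W (t + 1) ω' j =
        (if i = j then 1 else 0) * wvec W (t + 1) ω' j := by
      by_cases hij : i = j
      · subst hij; simp [wvec]
      · simp only [wvec, hij, if_false, zero_mul]
        by_cases h1 : W (t + 1) ω' = i
        · have : W (t + 1) ω' ≠ j := fun h2 => hij (h1.symm.trans h2)
          simp [this]
        · simp [h1]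
    linear_combination this
  have hm : ∀ (c : ℝ) (k : Fin (n + 1)), cexp P W t (fun ω' => c * wvec W (t + 1) ω' k) ω =
      c * Pt P W t k ω := fun c k =>
    cexp_mul P W t (fun _ => c) (fun ω' => wvec W (t + 1) ω' k) (fun _ _ _ => rfl) ω
  rw [h1, cexp_sub, cexp_sub, cexp_sub, cexp_const, hm, hm, hm]
  split_ifs <;> ring

lemma vecMul_EMM (P : FinProb Ω) (W : ℕ → Ω → Fin (n + 1)) (t : ℕ) (ω : Ω)
    (s : Fin (n + 1) → ℝ) (k : Fin (n + 1)) :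
    Matrix.vecMul s (EMM P W t ω) k =
      Pt P W t k ω * (s k - ∑ i, s i * Pt P W t i ω) := by
  simp only [Matrix.vecMul, dotProduct, EMM_apply, mul_sub, Finset.sum_sub_distrib]
  congr 1
  · simp [mul_comm]
  · rw [Finset.mul_sum]
    exact Finset.sum_congr rfl fun i _ => by ring

/-- martingale representation process of `V` -/
noncomputable def repZ (P : FinProb Ω) (W : ℕ → Ω → Fin (n + 1)) (t : ℕ) (V : Ω → ℝ) (ω : Ω) :
    Fin (n + 1) → ℝ :=
  fun k => (Pt P W t k ω)⁻¹ * cexp P W t (fun ω' => V ω' * wvec W (t + 1) ω' k) ω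

lemma repZ_measF (P : FinProb Ω) (W : ℕ → Ω → Fin (n + 1)) (t : ℕ) (V : Ω → ℝ) :
    measF W t (repZ P W t V) := by
  intro ω ω' h
  funext k
  unfold repZ
  rw [Pt_measF P W t k ω ω' h, cexp_measF P W t _ ω ω' h]

lemma repZ_sub (P : FinProb Ω) (W : ℕ → Ω → Fin (n + 1)) (t : ℕ) (V V' : Ω → ℝ) (ω : Ω) :
    repZ P W t (fun ω => V ω - V' ω) ω = repZ P W t V ω - repZ P W t V' ω := by
  funext k
  simp only [repZ, sub_mul, cexp_sub, mul_sub, Pi.sub_apply]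

lemma repZ_spec (P : FinProb Ω) (W : ℕ → Ω → Fin (n + 1)) (t : ℕ)
    (hpos : ∀ k ω, 0 < Pt P W t k ω) (V : Ω → ℝ) (hV : measF W (t + 1) V) (ω : Ω) :
    repZ P W t V ω (W (t + 1) ω) = V ω := by
  unfold repZ
  have h1 : cexp P W t (fun ω' => V ω' * wvec W (t + 1) ω' (W (t + 1) ω)) ω =
      cexp P W t (fun ω' => V ω * wvec W (t + 1) ω' (W (t + 1) ω)) ω := by
    apply cexp_congr
    intro ω' h
    by_cases h' : W (t + 1) ω' = W (t + 1) ω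
    · rw [hV ω ω' (samePath_succ h h'.symm)]
    · simp [wvec, h']
  have h2 : cexp P W t (fun ω' => V ω * wvec W (t + 1) ω' (W (t + 1) ω)) ω =
      V ω * Pt P W t (W (t + 1) ω) ω :=
    cexp_mul P W t (fun _ => V ω) (fun ω' => wvec W (t + 1) ω' (W (t + 1) ω))
      (fun _ _ _ => rfl) ω
  rw [h1, h2]
  have := (hpos (W (t + 1) ω) ω).ne'
  field_simp

lemma repZ_cexp (P : FinProb Ω) (W : ℕ → Ω → Fin (n + 1)) (t : ℕ)
    (hpos : ∀ k ω, 0 < Pt P W t k ω) (V : Ω → ℝ) (ω : Ω) :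
    ∑ k, repZ P W t V ω k * Pt P W t k ω = cexp P W t V ω := by
  have h1 : cexp P W t V ω = cexp P W t (fun ω' => ∑ k, V ω' * wvec W (t + 1) ω' k) ω := by
    congr 1
    funext ω'
    rw [← Finset.mul_sum]; simp [wvec]
  rw [h1, cexp_sum]
  refine Finset.sum_congr rfl fun k _ => ?_
  unfold repZ
  have := (hpos k ω).ne'
  field_simp

lemma rep_decomp (P : FinProb Ω) (W : ℕ → Ω → Fin (n + 1)) (t : ℕ)
    (hpos : ∀ k ω, 0 < Pt P W t k ω) (V : Ω → ℝ) (hV : measF W (t + 1) V) (ω : Ω) :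
    V ω = cexp P W t V ω + dotProduct (repZ P W t V ω) (Mdiff P W t ω) := by
  rw [dot_Mdiff, repZ_cexp P W t hpos, repZ_spec P W t hpos V hV]; ring

lemma dot_Mdiff_eq (P : FinProb Ω) (W : ℕ → Ω → Fin (n + 1)) (t : ℕ)
    (hpos : ∀ k ω, 0 < Pt P W t k ω) (s : Fin (n + 1) → ℝ) (ω : Ω) :
    dotProduct s (Mdiff P W t ω) = (Pt P W t (W (t + 1) ω) ω)⁻¹ *
      Matrix.vecMul s (EMM P W t ω) (W (t + 1) ω) := by
  rw [dot_Mdiff, vecMul_EMM, ← mul_assoc, inv_mul_cancel₀ (hpos _ ω).ne', one_mul]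

lemma sum_dot_V (P : FinProb Ω) (W : ℕ → Ω → Fin (n + 1)) (t : ℕ)
    (hpos : ∀ k ω, 0 < Pt P W t k ω) (V : Ω → ℝ) (hV : measF W (t + 1) V)
    (s : Ω → Fin (n + 1) → ℝ) (hs : measF W t s) :
    ∑ ω, P.p ω * (dotProduct (s ω) (Mdiff P W t ω) * V ω) =
      ∑ ω, P.p ω * dotProduct (Matrix.vecMul (s ω) (EMM P W t ω)) (repZ P W t V ω) := by
  have h1 : ∀ ω, dotProduct (s ω) (Mdiff P W t ω) * V ω =
      ∑ k, ((s ω k - ∑ i, s ω i * Pt P W t i ω) * repZ P W t V ω k) * wvec W (t + 1) ω k := by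
    intro ω
    rw [sum_wvec (s := fun k => (s ω k - ∑ i, s ω i * Pt P W t i ω) * repZ P W t V ω k),
      repZ_spec P W t hpos V hV, dot_Mdiff]
  have h2 : ∀ ω, dotProduct (Matrix.vecMul (s ω) (EMM P W t ω)) (repZ P W t V ω) =
      ∑ k, ((s ω k - ∑ i, s ω i * Pt P W t i ω) * repZ P W t V ω k) * Pt P W t k ω := by
    intro ω
    simp only [dotProduct, vecMul_EMM]
    exact Finset.sum_congr rfl fun i _ => by ring
  simp_rw [h1, h2, Finset.mul_sum]
  rw [Finset.sum_comm]
  rw [Finset.sum_comm (s := univ) (t := univ) (f := fun ω k => P.p ω * _)]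
  refine Finset.sum_congr rfl fun k _ => ?_
  have := sum_mul_cexp P W t
    (fun ω => (s ω k - ∑ i, s ω i * Pt P W t i ω) * repZ P W t V ω k)
    (fun ω => wvec W (t + 1) ω k) (by
      intro ω ω' h
      have hP : ∀ i, Pt P W t i ω = Pt P W t i ω' := fun i => Pt_measF P W t i ω ω' h
      simp only [hs ω ω' h, repZ_measF P W t V ω ω' h, hP])
  exact this

lemma zItil_apply (z : Fin (n + 1) → ℝ) (j : Fin n) :
    zItil z j = z j.castSucc - z (Fin.last n) := by
  simp only [zItil, Matrix.vecMul, dotProduct, Itil]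
  rw [Fin.sum_univ_castSucc]
  have h1 : ∀ i : Fin n, (z i.castSucc * if ((i.castSucc : Fin (n + 1)) : ℕ) = (j : ℕ) then (1 : ℝ)
      else if ((i.castSucc : Fin (n + 1)) : ℕ) = n then -1 else 0) =
      if i = j then z i.castSucc else 0 := by
    intro i
    have hi := i.2
    by_cases h : i = j
    · subst h; simp
    · have h' : (i : ℕ) ≠ j := fun e => h (Fin.ext e)
      simp [h, h', hi.ne]
  simp_rw [h1]
  have hj : n ≠ (j : ℕ) := j.2.ne'
  simp [hj]
  ring

lemma zItil_sub (z z' : Fin (n + 1) → ℝ) : zItil (z - z') = zItil z - zItil z' := by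
  funext j; simp [zItil_apply]; ring

lemma dot_Mdiff_zItil (P : FinProb Ω) (W : ℕ → Ω → Fin (n + 1)) (t : ℕ) (ω : Ω)
    (z : Fin (n + 1) → ℝ) :
    dotProduct z (Mdiff P W t ω) = ∑ j : Fin n, zItil z j * Mdiff P W t ω j.castSucc := by
  have h0 : ∑ k, Mdiff P W t ω k = 0 := by
    have := dot_Mdiff P W t ω (fun _ => 1)
    simpa [dotProduct, sum_Pt] using this
  rw [Fin.sum_univ_castSucc] at h0
  simp only [dotProduct, zItil_apply, sub_mul, Finset.sum_sub_distrib]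
  rw [Fin.sum_univ_castSucc, ← Finset.mul_sum]
  linear_combination z (Fin.last n) * h0

end ProbHelpers

section CoreHelpers

variable {Ω : Type*} [Fintype Ω] [DecidableEq Ω] {n : ℕ}

lemma sum_shift (g k : ℕ → ℝ) (m : ℕ) :
    ∑ t ∈ range (m + 1), (g (t + 1) + k t) =
      k 0 + ∑ t ∈ range m, (g (t + 1) + k (t + 1)) + g (m + 1) := by
  rw [Finset.sum_add_distrib, Finset.sum_add_distrib,
    Finset.sum_range_succ (fun t => g (t + 1)), Finset.sum_range_succ' k]
  ring

lemma mono_core (P : FinProb Ω) (W : ℕ → Ω → Fin (n + 1)) (T : ℕ) (hT : 1 ≤ T)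
    (hpos : ∀ t < T, ∀ k ω, 0 < Pt P W t k ω) (c2 : ℝ) (hc2 : 0 < c2)
    (x y v bb ff : ℕ → Ω → ℝ) (ss : ℕ → Ω → Fin (n + 1) → ℝ)
    (hx : ∀ t ≤ T, measF W t (x t)) (hv : ∀ t < T, measF W (t + 1) (v t))
    (hb : ∀ t < T, measF W t (bb t)) (hs : ∀ t < T, measF W t (ss t))
    (hy : ∀ t < T, ∀ ω, y t ω = cexp P W t (v t) ω)
    (hx0 : ∀ ω, x 0 ω = 0)
    (hyT : ∀ ω, c2 * x T ω ^ 2 ≤ y T ω * x T ω)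
    (hfT : ∀ ω, c2 * x T ω ^ 2 ≤ ff T ω * x T ω)
    (h0 : ∀ ω, bb 0 ω * y 0 ω +
      dotProduct (Matrix.vecMul (ss 0 ω) (EMM P W 0 ω)) (repZ P W 0 (v 0) ω) ≤
        -c2 * (y 0 ω ^ 2 + nr (zItil (repZ P W 0 (v 0) ω)) ^ 2))
    (hm : ∀ t, 1 ≤ t → t < T → ∀ ω, -ff t ω * x t ω + bb t ω * y t ω +
      dotProduct (Matrix.vecMul (ss t ω) (EMM P W t ω)) (repZ P W t (v t) ω) ≤
        -c2 * (|x t ω| + |y t ω| + nr (zItil (repZ P W t (v t) ω))) ^ 2) :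
    c2 * ∑ t ∈ range T, ∑ ω, P.p ω * (x (t + 1) ω ^ 2 + y t ω ^ 2 +
      nr (zItil (repZ P W t (v t) ω)) ^ 2) ≤
    ∑ t ∈ range T, ∑ ω, P.p ω * ((x (t + 1) ω - x t ω - bb t ω -
      dotProduct (ss t ω) (Mdiff P W t ω)) * v t ω +
      (-v t ω + y (t + 1) ω + ff (t + 1) ω) * x (t + 1) ω) := by
  set A : ℕ → ℝ := fun t => ∑ ω, P.p ω * (x t ω * y t ω) with hA
  set D : ℕ → ℝ := fun t => ∑ ω, P.p ω *
    dotProduct (Matrix.vecMul (ss t ω) (EMM P W t ω)) (repZ P W t (v t) ω) with hD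
  set β : ℕ → ℝ := fun t => -∑ ω, P.p ω * (bb t ω * y t ω) - D t with hβ
  set φ : ℕ → ℝ := fun t => ∑ ω, P.p ω * (ff t ω * x t ω) with hφ
  set q : ℕ → ℝ := fun t => ∑ ω, P.p ω * (x t ω ^ 2) with hq
  set r : ℕ → ℝ := fun t => ∑ ω, P.p ω * (y t ω ^ 2 +
      nr (zItil (repZ P W t (v t) ω)) ^ 2) with hr
  have e1 : ∀ t ∈ range T, ∑ ω, P.p ω * ((x (t + 1) ω - x t ω - bb t ω -
      dotProduct (ss t ω) (Mdiff P W t ω)) * v t ω +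
      (-v t ω + y (t + 1) ω + ff (t + 1) ω) * x (t + 1) ω) =
      (A (t + 1) - A t) + (φ (t + 1) + β t) := by
    intro t ht
    have ht' : t < T := Finset.mem_range.1 ht
    have a1 := sum_mul_cexp P W t (x t) (v t) (hx t ht'.le)
    have a2 := sum_mul_cexp P W t (bb t) (v t) (hb t ht')
    have a3 := sum_dot_V P W t (hpos t ht') (v t) (hv t ht') (ss t) (hs t ht')
    simp_rw [← hy t ht'] at a1 a2
    have a4 : ∑ ω, P.p ω * ((x (t + 1) ω - x t ω - bb t ω -
      dotProduct (ss t ω) (Mdiff P W t ω)) * v t ω +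
      (-v t ω + y (t + 1) ω + ff (t + 1) ω) * x (t + 1) ω) =
      A (t + 1) - ∑ ω, P.p ω * (x t ω * v t ω) + (φ (t + 1) +
        (-(∑ ω, P.p ω * (bb t ω * v t ω)) -
        ∑ ω, P.p ω * (dotProduct (ss t ω) (Mdiff P W t ω) * v t ω))) := by
      simp only [hA, hφ, ← Finset.sum_neg_distrib, ← Finset.sum_add_distrib,
        ← Finset.sum_sub_distrib]
      exact Finset.sum_congr rfl fun ω _ => by ring
    rw [a4, a1, a2, a3]
  have e2 : ∀ t ∈ range T, ∑ ω, P.p ω * (x (t + 1) ω ^ 2 + y t ω ^ 2 +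
      nr (zItil (repZ P W t (v t) ω)) ^ 2) = q (t + 1) + r t := by
    intro t _
    simp only [hq, hr, ← Finset.sum_add_distrib]
    exact Finset.sum_congr rfl fun ω _ => by ring
  rw [Finset.sum_congr rfl e1, Finset.sum_add_distrib,
    Finset.sum_range_sub, Finset.sum_congr rfl e2]
  obtain ⟨m, rfl⟩ : ∃ m, T = m + 1 := ⟨T - 1, by omega⟩
  rw [sum_shift, sum_shift]
  have hA0 : A 0 = 0 := by simp [hA, hx0]
  have hAT : c2 * q (m + 1) ≤ A (m + 1) := by
    simp only [hq, hA, Finset.mul_sum]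
    refine Finset.sum_le_sum fun ω _ => ?_
    have := mul_le_mul_of_nonneg_left (hyT ω) (P.pos ω).le
    linarith
  have hφT : 0 ≤ φ (m + 1) := by
    simp only [hφ]
    refine Finset.sum_nonneg fun ω _ => mul_nonneg (P.pos ω).le ?_
    exact le_trans (by positivity) (hfT ω)
  have hβ0 : c2 * r 0 ≤ β 0 := by
    simp only [hβ, hr, hD, Finset.mul_sum, ← Finset.sum_neg_distrib,
        ← Finset.sum_sub_distrib]
    refine Finset.sum_le_sum fun ω _ => ?_
    have := mul_le_mul_of_nonneg_left (h0 ω) (P.pos ω).le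
    linarith
  have hmid : ∀ t ∈ range m, c2 * (q (t + 1) + r (t + 1)) ≤ φ (t + 1) + β (t + 1) := by
    intro t ht
    have ht' := Finset.mem_range.1 ht
    simp only [hβ, hφ, hr, hq, hD, Finset.mul_sum, ← Finset.sum_neg_distrib, mul_add,
        ← Finset.sum_sub_distrib, ← Finset.sum_add_distrib]
    refine Finset.sum_le_sum fun ω _ => ?_
    have h1 := hm (t + 1) (by omega) (by omega) ω
    set a := x (t + 1) ω
    set b := y (t + 1) ω
    set c := nr (zItil (repZ P W (t + 1) (v (t + 1)) ω))
    have h2 : a ^ 2 + b ^ 2 + c ^ 2 ≤ (|a| + |b| + c) ^ 2 := by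
      have hc : 0 ≤ c := nr_nonneg _
      have := abs_nonneg a
      have := abs_nonneg b
      rw [← sq_abs a, ← sq_abs b]
      nlinarith [mul_nonneg (abs_nonneg a) (abs_nonneg b), mul_nonneg (abs_nonneg a) hc,
        mul_nonneg (abs_nonneg b) hc]
    have h3 := mul_le_mul_of_nonneg_left h2 hc2.le
    have h4 := mul_le_mul_of_nonneg_left (h1.trans (by linarith :
      _ ≤ -(c2 * (a ^ 2 + b ^ 2 + c ^ 2)))) (P.pos ω).le
    linarith
  have hmid' := Finset.sum_le_sum hmid
  rw [← Finset.mul_sum] at hmid'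
  rw [hA0]
  linarith

lemma norm_core (P : FinProb Ω) (W : ℕ → Ω → Fin (n + 1)) (T : ℕ)
    (hpos : ∀ t < T, ∀ k ω, 0 < Pt P W t k ω) (c2 : ℝ) (hc2 : 0 < c2) :
    ∃ c > 0, ∀ (x y v : ℕ → Ω → ℝ), (∀ t < T, measF W (t + 1) (v t)) →
    (∀ t < T, ∀ ω, y t ω = cexp P W t (v t) ω) →
    c * ∑ t ∈ range T, ∑ ω, (x (t + 1) ω ^ 2 + v t ω ^ 2) ≤
    c2 * ∑ t ∈ range T, ∑ ω, P.p ω * (x (t + 1) ω ^ 2 + y t ω ^ 2 +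
      nr (zItil (repZ P W t (v t) ω)) ^ 2) := by
  have hne : Nonempty Ω := by
    by_contra hcon
    rw [not_nonempty_iff] at hcon
    have := P.sum_one
    simp at this
  obtain ⟨ω0, hω0⟩ := Finite.exists_min P.p
  set B : ℝ := ∑ t ∈ range T, ∑ ω, ∑ j : Fin n, Mdiff P W t ω j.castSucc ^ 2 with hB
  have hB0 : 0 ≤ B := by positivity
  have hBle : ∀ t < T, ∀ ω, ∑ j : Fin n, Mdiff P W t ω j.castSucc ^ 2 ≤ B := by
    intro t ht ω
    have h1 : ∑ j : Fin n, Mdiff P W t ω j.castSucc ^ 2 ≤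
        ∑ ω, ∑ j : Fin n, Mdiff P W t ω j.castSucc ^ 2 :=
      Finset.single_le_sum (f := fun ω => ∑ j : Fin n, Mdiff P W t ω j.castSucc ^ 2)
        (fun _ _ => Finset.sum_nonneg fun _ _ => sq_nonneg _) (Finset.mem_univ ω)
    have h2 : ∑ ω, ∑ j : Fin n, Mdiff P W t ω j.castSucc ^ 2 ≤ B :=
      Finset.single_le_sum (f := fun t => ∑ ω, ∑ j : Fin n, Mdiff P W t ω j.castSucc ^ 2)
        (fun _ _ => Finset.sum_nonneg fun _ _ => Finset.sum_nonneg fun _ _ => sq_nonneg _)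
        (Finset.mem_range.2 ht)
    exact h1.trans h2
  clear_value B
  have hδ := P.pos ω0
  refine ⟨c2 * P.p ω0 / (2 + 2 * B), by positivity, ?_⟩
  intro x y v hv hy
  rw [Finset.mul_sum, Finset.mul_sum]
  apply Finset.sum_le_sum
  intro t ht
  rw [Finset.mul_sum, Finset.mul_sum]
  apply Finset.sum_le_sum
  intro ω _
  have ht' := Finset.mem_range.1 ht
  have h1 : v t ω ^ 2 ≤ (2 + 2 * B) * (y t ω ^ 2 + nr (zItil (repZ P W t (v t) ω)) ^ 2) := by
    have h2 := rep_decomp P W t (hpos t ht') (v t) (hv t ht') ω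
    rw [← hy t ht', dot_Mdiff_zItil] at h2
    have h3 := Finset.sum_mul_sq_le_sq_mul_sq univ (zItil (repZ P W t (v t) ω))
      (fun j : Fin n => Mdiff P W t ω j.castSucc)
    rw [← nr_sq] at h3
    have h4 := mul_le_mul_of_nonneg_left (hBle t ht' ω)
      (sq_nonneg (nr (zItil (repZ P W t (v t) ω))))
    set d := ∑ j : Fin n, zItil (repZ P W t (v t) ω) j * Mdiff P W t ω j.castSucc
    rw [h2]
    have h5 : (y t ω + d) ^ 2 ≤ 2 * y t ω ^ 2 + 2 * d ^ 2 := by nlinarith [sq_nonneg (y t ω - d)]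
    nlinarith [mul_nonneg hB0 (sq_nonneg (y t ω)), sq_nonneg (nr (zItil (repZ P W t (v t) ω)))]
  have h2 : x (t + 1) ω ^ 2 ≤ (2 + 2 * B) * x (t + 1) ω ^ 2 := by
    nlinarith [sq_nonneg (x (t + 1) ω), mul_nonneg hB0 (sq_nonneg (x (t + 1) ω))]
  have h3 : x (t + 1) ω ^ 2 + v t ω ^ 2 ≤ (2 + 2 * B) * (x (t + 1) ω ^ 2 + y t ω ^ 2 +
      nr (zItil (repZ P W t (v t) ω)) ^ 2) := by linarith
  have hq : 0 ≤ c2 * (x (t + 1) ω ^ 2 + y t ω ^ 2 +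
      nr (zItil (repZ P W t (v t) ω)) ^ 2) := by positivity
  calc _ ≤ c2 * P.p ω0 / (2 + 2 * B) * ((2 + 2 * B) * (x (t + 1) ω ^ 2 + y t ω ^ 2 +
      nr (zItil (repZ P W t (v t) ω)) ^ 2)) := mul_le_mul_of_nonneg_left h3 (by positivity)
    _ = P.p ω0 * (c2 * (x (t + 1) ω ^ 2 + y t ω ^ 2 +
      nr (zItil (repZ P W t (v t) ω)) ^ 2)) := by field_simp
    _ ≤ P.p ω * (c2 * (x (t + 1) ω ^ 2 + y t ω ^ 2 +
      nr (zItil (repZ P W t (v t) ω)) ^ 2)) := mul_le_mul_of_nonneg_right (hω0 ω) hq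
    _ = _ := by ring

/-- index set of the unknowns -/
abbrev Idx (Ω : Type*) (T : ℕ) := (Fin T × Ω) ⊕ (Fin T × Ω)

/-- the forward process encoded by `u` -/
noncomputable def procX (T : ℕ) (x0 : ℝ) (u : EuclideanSpace ℝ (Idx Ω T)) (t : ℕ) (ω : Ω) : ℝ :=
  match t with
  | 0 => x0
  | s + 1 => if hs : s < T then u (Sum.inl (⟨s, hs⟩, ω)) else 0

/-- the process `Y_t + Z_t M_{t+1}` encoded by `u` -/
noncomputable def procV (T : ℕ) (u : EuclideanSpace ℝ (Idx Ω T)) (t : ℕ) (ω : Ω) : ℝ :=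
  if hs : t < T then u (Sum.inr (⟨t, hs⟩, ω)) else 0

lemma coord_isLip {ι : Type*} [Fintype ι] (i : ι) :
    IsLip (fun u : EuclideanSpace ℝ ι => u i) := by
  refine ⟨1, fun u v => ?_⟩
  have := PiLp.norm_apply_le (u - v) i
  simpa using this

lemma procX_isLip (T : ℕ) (x0 : ℝ) (t : ℕ) (ω : Ω) :
    IsLip (fun u : EuclideanSpace ℝ (Idx Ω T) => procX T x0 u t ω) := by
  cases t with
  | zero => exact IsLip.const x0
  | succ s =>
    by_cases hs : s < T
    · simpa [procX, hs] using coord_isLip (Sum.inl (⟨s, hs⟩, ω) : Idx Ω T)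
    · simpa [procX, hs] using IsLip.const 0

lemma procV_isLip (T : ℕ) (t : ℕ) (ω : Ω) :
    IsLip (fun u : EuclideanSpace ℝ (Idx Ω T) => procV T u t ω) := by
  by_cases hs : t < T
  · simpa [procV, hs] using coord_isLip (Sum.inr (⟨t, hs⟩, ω) : Idx Ω T)
  · simpa [procV, hs] using IsLip.const 0

lemma cexp_isLip {E : Type*} [NormedAddCommGroup E] (P : FinProb Ω) (W : ℕ → Ω → Fin (n + 1))
    (t : ℕ) (ω : Ω) {V : E → Ω → ℝ} (hV : ∀ ω, IsLip (fun u => V u ω)) :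
    IsLip (fun u => cexp P W t (V u) ω) := by
  simp only [cexp_real]
  exact (IsLip.sum _ fun ω' _ => (hV ω').cmul _).cmul _

lemma zi_isLip {E : Type*} [NormedAddCommGroup E] (P : FinProb Ω) (W : ℕ → Ω → Fin (n + 1))
    (t : ℕ) (ω : Ω) {V : E → Ω → ℝ} (hV : ∀ ω, IsLip (fun u => V u ω)) (j : Fin n) :
    IsLip (fun u => zItil (repZ P W t (V u) ω) j) := by
  have h1 : ∀ k, IsLip (fun u => repZ P W t (V u) ω k) := by
    intro k
    unfold repZ
    refine (cexp_isLip P W t ω (V := fun u ω' => V u ω' * wvec W (t + 1) ω' k) ?_).cmul _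
    intro ω'
    simp_rw [mul_comm _ (wvec W (t + 1) ω' k)]
    exact (hV ω').cmul _
  simp only [zItil_apply]
  exact (h1 _).sub (h1 _)

/-- adapted elements -/
def adaptedS (W : ℕ → Ω → Fin (n + 1)) (T : ℕ) : Submodule ℝ (EuclideanSpace ℝ (Idx Ω T)) where
  carrier := {u | ∀ t : Fin T, measF W (t + 1) (fun ω => u (Sum.inl (t, ω))) ∧
    measF W (t + 1) (fun ω => u (Sum.inr (t, ω)))}
  add_mem' := by
    intro a b ha hb t
    refine ⟨fun ω ω' h => ?_, fun ω ω' h => ?_⟩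
    · have h1 := (ha t).1 ω ω' h
      have h2 := (hb t).1 ω ω' h
      simp only at h1 h2
      simp [h1, h2]
    · have h1 := (ha t).2 ω ω' h
      have h2 := (hb t).2 ω ω' h
      simp only at h1 h2
      simp [h1, h2]
  zero_mem' := by
    intro t
    exact ⟨fun ω ω' h => by simp, fun ω ω' h => by simp⟩
  smul_mem' := by
    intro c a ha t
    refine ⟨fun ω ω' h => ?_, fun ω ω' h => ?_⟩
    · have h1 := (ha t).1 ω ω' h
      simp only at h1
      simp [h1]
    · have h1 := (ha t).2 ω ω' h
      simp only at h1
      simp [h1]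

lemma procX_measF {W : ℕ → Ω → Fin (n + 1)} {T : ℕ} (x0 : ℝ) {u : EuclideanSpace ℝ (Idx Ω T)}
    (hu : u ∈ adaptedS W T) (t : ℕ) : measF W t (procX T x0 u t) := by
  intro ω ω' h
  cases t with
  | zero => rfl
  | succ s =>
    by_cases hs : s < T
    · simpa [procX, hs] using (hu ⟨s, hs⟩).1 ω ω' h
    · simp [procX, hs]

lemma procV_measF {W : ℕ → Ω → Fin (n + 1)} {T : ℕ} {u : EuclideanSpace ℝ (Idx Ω T)}
    (hu : u ∈ adaptedS W T) (t : ℕ) : measF W (t + 1) (procV T u t) := by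
  intro ω ω' h
  by_cases hs : t < T
  · simpa [procV, hs] using (hu ⟨t, hs⟩).2 ω ω' h
  · simp [procV, hs]

lemma sum_Idx (T : ℕ) (g k : ℕ → Ω → ℝ) (F : Idx Ω T → ℝ)
    (hg : ∀ (t : Fin T) ω, F (Sum.inl (t, ω)) = g t ω)
    (hk : ∀ (t : Fin T) ω, F (Sum.inr (t, ω)) = k t ω) :
    ∑ i, F i = ∑ t ∈ range T, ∑ ω, (g t ω + k t ω) := by
  rw [Fintype.sum_sum_type, Fintype.sum_prod_type, Fintype.sum_prod_type]
  simp only [hg, hk]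
  rw [Finset.sum_range, ← Finset.sum_add_distrib]
  simp only [Finset.sum_add_distrib]

end CoreHelpers

/-- existence for the monotone nonlinear FBSΔE via continuation. -/
theorem stmt16 {Ω : Type*} [Fintype Ω] [DecidableEq Ω] {n : ℕ}
    (P : FinProb Ω) (W : ℕ → Ω → Fin (n + 1)) (T : ℕ) (hT : 1 ≤ T)
    (hpos : ∀ t < T, ∀ k ω, 0 < Pt P W t k ω)
    (c1 c2 : ℝ) (hc1 : 0 < c1) (hc2 : 0 < c2)
    (b f : ℕ → Ω → ℝ → ℝ → (Fin n → ℝ) → ℝ)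
    (σ : ℕ → Ω → ℝ → ℝ → (Fin n → ℝ) → (Fin (n + 1) → ℝ))
    (h : Ω → ℝ → ℝ) (x0 : ℝ)
    (hbad : ∀ t x y zi, measF W t (fun ω => b t ω x y zi))
    (hsad : ∀ t x y zi, measF W t (fun ω => σ t ω x y zi))
    (hfad : ∀ t x y zi, measF W t (fun ω => f t ω x y zi))
    (hhad : measF W T h)
    (hfT : ∀ ω x y zi zi', f T ω x y zi = f T ω x y zi')
    (hLip : ∀ t < T, ∀ ω x y (zi : Fin n → ℝ) x' y' (zi' : Fin n → ℝ),
      |f t ω x y zi - f t ω x' y' zi'| + |b t ω x y zi - b t ω x' y' zi'| +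
          nr (Matrix.vecMul (σ t ω x y zi - σ t ω x' y' zi') (EMM P W t ω)) ≤
        c1 * (|x - x'| + |y - y'| + nr (zi - zi')))
    (hLipfT : ∀ ω x y (zi : Fin n → ℝ) x' y' (zi' : Fin n → ℝ),
      |f T ω x y zi - f T ω x' y' zi'| ≤ c1 * (|x - x'| + |y - y'|))
    (hLiph : ∀ ω x x', |h ω x - h ω x'| ≤ c1 * |x - x'|)
    (hmono : ∀ t, 1 ≤ t → t < T → ∀ ω x y x' y' (z z' : Fin (n + 1) → ℝ),
      (-(f t ω x y (zItil z)) + f t ω x' y' (zItil z')) * (x - x') +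
          (b t ω x y (zItil z) - b t ω x' y' (zItil z')) * (y - y') +
          dotProduct
            (Matrix.vecMul (σ t ω x y (zItil z) - σ t ω x' y' (zItil z')) (EMM P W t ω))
            (z - z') ≤
        -c2 * (|x - x'| + |y - y'| + nr (zItil (z - z'))) ^ 2)
    (hmonoT : ∀ ω x y x' y' (zi zi' : Fin n → ℝ),
      (-(f T ω x y zi) + f T ω x' y' zi') * (x - x') ≤ -c2 * (x - x') ^ 2)
    (hmono0 : ∀ ω x y x' y' (z z' : Fin (n + 1) → ℝ),
      (b 0 ω x y (zItil z) - b 0 ω x' y' (zItil z')) * (y - y') +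
          dotProduct
            (Matrix.vecMul (σ 0 ω x y (zItil z) - σ 0 ω x' y' (zItil z')) (EMM P W 0 ω))
            (z - z') ≤
        -c2 * ((y - y') ^ 2 + nr (zItil (z - z')) ^ 2))
    (hmonoh : ∀ ω x x', (h ω x - h ω x') * (x - x') ≥ c2 * (x - x') ^ 2)
 :
    ∃ (X Y : ℕ → Ω → ℝ) (Z : ℕ → Ω → Fin (n + 1) → ℝ),
      ((∀ t ≤ T, measF W t (X t)) ∧ (∀ t ≤ T, measF W t (Y t)) ∧
        (∀ t < T, measF W t (Z t)) ∧
        (∀ t < T, ∀ ω, X (t + 1) ω - X t ω =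
            b t ω (X t ω) (Y t ω) (zItil (Z t ω)) +
            dotProduct (σ t ω (X t ω) (Y t ω) (zItil (Z t ω))) (Mdiff P W t ω)) ∧
        (∀ t < T, ∀ ω, Y (t + 1) ω - Y t ω =
            -(f (t + 1) ω (X (t + 1) ω) (Y (t + 1) ω) (zItil (Z (t + 1) ω))) +
            dotProduct (Z t ω) (Mdiff P W t ω)) ∧
        (∀ ω, X 0 ω = x0) ∧ (∀ ω, Y T ω = h ω (X T ω))) := by
  classical
  let X : EuclideanSpace ℝ (Idx Ω T) → ℕ → Ω → ℝ := fun u => procX T x0 u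
  let V : EuclideanSpace ℝ (Idx Ω T) → ℕ → Ω → ℝ := fun u => procV T u
  let Y : EuclideanSpace ℝ (Idx Ω T) → ℕ → Ω → ℝ := fun u t ω =>
    if t < T then cexp P W t (V u t) ω else h ω (X u t ω)
  let Z : EuclideanSpace ℝ (Idx Ω T) → ℕ → Ω → Fin (n + 1) → ℝ := fun u t =>
    repZ P W t (V u t)
  let bb : EuclideanSpace ℝ (Idx Ω T) → ℕ → Ω → ℝ := fun u t ω =>
    b t ω (X u t ω) (Y u t ω) (zItil (Z u t ω))
  let ff : EuclideanSpace ℝ (Idx Ω T) → ℕ → Ω → ℝ := fun u t ω =>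
    f t ω (X u t ω) (Y u t ω) (zItil (Z u t ω))
  let ss : EuclideanSpace ℝ (Idx Ω T) → ℕ → Ω → Fin (n + 1) → ℝ := fun u t ω =>
    σ t ω (X u t ω) (Y u t ω) (zItil (Z u t ω))
  let G1 : EuclideanSpace ℝ (Idx Ω T) → ℕ → Ω → ℝ := fun u t ω =>
    X u (t + 1) ω - X u t ω - bb u t ω - dotProduct (ss u t ω) (Mdiff P W t ω)
  let G2 : EuclideanSpace ℝ (Idx Ω T) → ℕ → Ω → ℝ := fun u t ω =>
    -V u t ω + Y u (t + 1) ω + ff u (t + 1) ω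
  let F : EuclideanSpace ℝ (Idx Ω T) → Idx Ω T → ℝ := fun u i =>
    Sum.elim (fun a => P.p a.2 * G2 u a.1 a.2) (fun a => P.p a.2 * G1 u a.1 a.2) i
  -- Lipschitz properties
  have hXl : ∀ t ω, IsLip (fun u => X u t ω) := fun t ω => procX_isLip T x0 t ω
  have hVl : ∀ t ω, IsLip (fun u => V u t ω) := fun t ω => procV_isLip T t ω
  have hYl : ∀ t ω, IsLip (fun u => Y u t ω) := by
    intro t ω
    by_cases ht : t < T
    · simp only [Y, ht, if_true]
      exact cexp_isLip P W t ω (hVl t)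
    · simp only [Y, ht, if_false]
      obtain ⟨K, hK⟩ := hXl t ω
      refine ⟨c1 * K, fun u v => (hLiph ω _ _).trans ?_⟩
      rw [mul_assoc]
      exact mul_le_mul_of_nonneg_left (hK u v) hc1.le
  have hZl : ∀ t ω j, IsLip (fun u => zItil (Z u t ω) j) := fun t ω j =>
    zi_isLip P W t ω (hVl t) j
  have hbl : ∀ t < T, ∀ ω, IsLip (fun u => bb u t ω) := by
    intro t ht ω
    refine IsLip.comp3 (B := b t ω) hc1.le ?_ (hXl t ω) (hYl t ω) (hZl t ω)
    intro x y zi x' y' zi'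
    refine le_trans ?_ (hLip t ht ω x y zi x' y' zi')
    linarith [abs_nonneg (f t ω x y zi - f t ω x' y' zi'),
      nr_nonneg (Matrix.vecMul (σ t ω x y zi - σ t ω x' y' zi') (EMM P W t ω))]
  have hfl : ∀ t ≤ T, ∀ ω, IsLip (fun u => ff u t ω) := by
    intro t ht ω
    refine IsLip.comp3 (B := f t ω) hc1.le ?_ (hXl t ω) (hYl t ω) (hZl t ω)
    intro x y zi x' y' zi'
    rcases ht.lt_or_eq with ht | rfl
    · refine le_trans ?_ (hLip t ht ω x y zi x' y' zi')
      linarith [abs_nonneg (b t ω x y zi - b t ω x' y' zi'),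
        nr_nonneg (Matrix.vecMul (σ t ω x y zi - σ t ω x' y' zi') (EMM P W t ω))]
    · refine (hLipfT ω x y zi x' y' zi').trans (mul_le_mul_of_nonneg_left ?_ hc1.le)
      linarith [nr_nonneg (zi - zi')]
  have hsl : ∀ t < T, ∀ ω, IsLip (fun u => dotProduct (ss u t ω) (Mdiff P W t ω)) := by
    intro t ht ω
    have hp := hpos t ht (W (t + 1) ω) ω
    refine IsLip.comp3 (B := fun x y zi => dotProduct (σ t ω x y zi) (Mdiff P W t ω))
      (C := (Pt P W t (W (t + 1) ω) ω)⁻¹ * c1) (by positivity) ?_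
      (hXl t ω) (hYl t ω) (hZl t ω)
    intro x y zi x' y' zi'
    rw [← sub_dotProduct, dot_Mdiff_eq P W t (hpos t ht), abs_mul, abs_of_pos (inv_pos.2 hp),
      mul_assoc]
    refine mul_le_mul_of_nonneg_left ?_ (inv_pos.2 hp).le
    refine (abs_le_nr _ _).trans (le_trans ?_ (hLip t ht ω x y zi x' y' zi'))
    linarith [abs_nonneg (b t ω x y zi - b t ω x' y' zi'),
      abs_nonneg (f t ω x y zi - f t ω x' y' zi')]
  have hFl : ∀ i, IsLip (fun u => F u i) := by
    rintro (⟨t, ω⟩ | ⟨t, ω⟩)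
    · exact ((((hVl t ω).neg).add (hYl (t + 1) ω)).add (hfl (t + 1) t.2 ω)).cmul (P.p ω)
    · exact ((((hXl (t + 1) ω).sub (hXl t ω)).sub (hbl t t.2 ω)).sub (hsl t t.2 ω)).cmul (P.p ω)
  -- adaptedness
  have hXm : ∀ u ∈ adaptedS W T, ∀ t, measF W t (X u t) := fun u hu t => procX_measF x0 hu t
  have hVm : ∀ u ∈ adaptedS W T, ∀ t, measF W (t + 1) (V u t) := fun u hu t => procV_measF hu t
  have hYm : ∀ u ∈ adaptedS W T, ∀ t ≤ T, measF W t (Y u t) := by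
    intro u hu t ht ω ω' hω
    by_cases ht' : t < T
    · simp only [Y, ht', if_true]
      exact cexp_measF P W t _ ω ω' hω
    · have : t = T := by omega
      subst this
      simp only [Y, ht', if_false]
      rw [hhad ω ω' hω, hXm u hu t ω ω' hω]
  have hZm : ∀ u t, measF W t (Z u t) := fun u t => repZ_measF P W t _
  have hbm : ∀ u ∈ adaptedS W T, ∀ t ≤ T, measF W t (bb u t) := by
    intro u hu t ht ω ω' hω
    simp only [bb]
    rw [hXm u hu t ω ω' hω, hYm u hu t ht ω ω' hω, hZm u t ω ω' hω]
    exact hbad t _ _ _ ω ω' hω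
  have hfm : ∀ u ∈ adaptedS W T, ∀ t ≤ T, measF W t (ff u t) := by
    intro u hu t ht ω ω' hω
    simp only [ff]
    rw [hXm u hu t ω ω' hω, hYm u hu t ht ω ω' hω, hZm u t ω ω' hω]
    exact hfad t _ _ _ ω ω' hω
  have hsm : ∀ u ∈ adaptedS W T, ∀ t ≤ T, measF W t (ss u t) := by
    intro u hu t ht ω ω' hω
    simp only [ss]
    rw [hXm u hu t ω ω' hω, hYm u hu t ht ω ω' hω, hZm u t ω ω' hω]
    exact hsad t _ _ _ ω ω' hω
  have hMm : ∀ t, measF W (t + 1) (Mdiff P W t) := by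
    intro t ω ω' hω
    funext k
    rw [Mdiff_apply, Mdiff_apply, Pt_measF P W t k ω ω' (samePath_mono hω)]
    simp only [wvec, hω (t + 1) (by simp)]
  have hG1m : ∀ u ∈ adaptedS W T, ∀ t < T, measF W (t + 1) (G1 u t) := by
    intro u hu t ht ω ω' hω
    have hω2 := samePath_mono hω
    simp only [G1]
    rw [hXm u hu (t + 1) ω ω' hω, hXm u hu t ω ω' hω2, hbm u hu t ht.le ω ω' hω2,
      hsm u hu t ht.le ω ω' hω2, hMm t ω ω' hω]
  have hG2m : ∀ u ∈ adaptedS W T, ∀ t < T, measF W (t + 1) (G2 u t) := by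
    intro u hu t ht ω ω' hω
    simp only [G2]
    rw [hVm u hu t ω ω' hω, hYm u hu (t + 1) ht ω ω' hω, hfm u hu (t + 1) ht ω ω' hω]
  have hXc : ∀ u (t : Fin T) ω, X u (t + 1) ω = u (Sum.inl (t, ω)) := by
    intro u t ω
    simp [X, procX]
  have hVc : ∀ u (t : Fin T) ω, V u t ω = u (Sum.inr (t, ω)) := by
    intro u t ω
    simp [V, procV]
  obtain ⟨c, hc, hcn⟩ := norm_core P W T hpos c2 hc2
  obtain ⟨u, hu, huv⟩ := exists_variational (adaptedS W T) F c hc hFl (by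
    intro u hu v hv
    have hYd : ∀ t < T, ∀ ω, Y u t ω - Y v t ω =
        cexp P W t (fun ω => V u t ω - V v t ω) ω := by
      intro t ht ω
      simp only [Y, ht, if_true, cexp_sub]
    have hVd : ∀ t < T, measF W (t + 1) (fun ω => V u t ω - V v t ω) := by
      intro t _ ω ω' hω
      simp only [hVm u hu t ω ω' hω, hVm v hv t ω ω' hω]
    have key := mono_core P W T hT hpos c2 hc2 (fun t ω => X u t ω - X v t ω)
      (fun t ω => Y u t ω - Y v t ω) (fun t ω => V u t ω - V v t ω)
      (fun t ω => bb u t ω - bb v t ω) (fun t ω => ff u t ω - ff v t ω)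
      (fun t ω => ss u t ω - ss v t ω)
      (by intro t _ ω ω' hω
          simp only [hXm u hu t ω ω' hω, hXm v hv t ω ω' hω])
      hVd
      (by intro t ht ω ω' hω
          simp only [hbm u hu t ht.le ω ω' hω, hbm v hv t ht.le ω ω' hω])
      (by intro t ht ω ω' hω
          simp only [hsm u hu t ht.le ω ω' hω, hsm v hv t ht.le ω ω' hω])
      hYd
      (by intro ω; simp [X, procX])
      (by intro ω
          simp only [Y, lt_irrefl, if_false]
          exact hmonoh ω _ _)
      (by intro ω
          have := hmonoT ω (X u T ω) (Y u T ω) (X v T ω) (Y v T ω)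
            (zItil (Z u T ω)) (zItil (Z v T ω))
          simp only [ff]
          linarith)
      (by intro ω
          have := hmono0 ω (X u 0 ω) (Y u 0 ω) (X v 0 ω) (Y v 0 ω) (Z u 0 ω) (Z v 0 ω)
          simp only [repZ_sub]
          exact this)
      (by intro t h1 h2 ω
          have := hmono t h1 h2 ω (X u t ω) (Y u t ω) (X v t ω) (Y v t ω) (Z u t ω) (Z v t ω)
          simp only [repZ_sub]
          have e : -(ff u t ω - ff v t ω) = -ff u t ω + ff v t ω := by ring
          rw [e]
          exact this)
    have hn := hcn (fun t ω => X u t ω - X v t ω)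
      (fun t ω => Y u t ω - Y v t ω) (fun t ω => V u t ω - V v t ω) hVd hYd
    have hfin := hn.trans key
    rw [sum_Idx T (fun t ω => (X u (t + 1) ω - X v (t + 1) ω) ^ 2)
      (fun t ω => (V u t ω - V v t ω) ^ 2) _ (by intro t ω; rw [hXc, hXc])
      (by intro t ω; rw [hVc, hVc])]
    rw [sum_Idx T (fun t ω => (P.p ω * G2 u t ω - P.p ω * G2 v t ω) *
        (X u (t + 1) ω - X v (t + 1) ω))
      (fun t ω => (P.p ω * G1 u t ω - P.p ω * G1 v t ω) * (V u t ω - V v t ω)) _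
      (by intro t ω; rw [hXc, hXc]; rfl)
      (by intro t ω; rw [hVc, hVc]; rfl)]
    refine hfin.trans (le_of_eq ?_)
    refine Finset.sum_congr rfl fun t _ => Finset.sum_congr rfl fun ω _ => ?_
    simp only [G1, G2, sub_dotProduct]
    ring)
  -- test against the residual
  have hG : ∀ t < T, ∀ ω, G2 u t ω = 0 ∧ G1 u t ω = 0 := by
    let w : EuclideanSpace ℝ (Idx Ω T) := WithLp.toLp 2
      (fun i => Sum.elim (fun a => G2 u a.1 a.2) (fun a => G1 u a.1 a.2) i)
    have hw : w ∈ adaptedS W T := fun t => ⟨hG2m u hu t t.2, hG1m u hu t t.2⟩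
    have h1 := huv w hw
    rw [sum_Idx T (fun t ω => P.p ω * G2 u t ω ^ 2) (fun t ω => P.p ω * G1 u t ω ^ 2) _
      (by intro t ω; simp only [F, w, Sum.elim_inl]; ring)
      (by intro t ω; simp only [F, w, Sum.elim_inr]; ring)] at h1
    have hnn : ∀ t ω, 0 ≤ P.p ω * G2 u t ω ^ 2 + P.p ω * G1 u t ω ^ 2 := by
      intro t ω
      have := P.pos ω
      positivity
    rw [Finset.sum_eq_zero_iff_of_nonneg
      (fun t _ => Finset.sum_nonneg fun ω _ => hnn t ω)] at h1
    intro t ht ω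
    have h2 := h1 t (Finset.mem_range.2 ht)
    rw [Finset.sum_eq_zero_iff_of_nonneg (fun ω _ => hnn t ω)] at h2
    have h3 := h2 ω (Finset.mem_univ ω)
    have hp := P.pos ω
    have h4 : 0 ≤ P.p ω * G2 u t ω ^ 2 := by positivity
    have h5 : 0 ≤ P.p ω * G1 u t ω ^ 2 := by positivity
    have h6 : P.p ω * G2 u t ω ^ 2 = 0 := by linarith
    have h7 : P.p ω * G1 u t ω ^ 2 = 0 := by linarith
    exact ⟨by simpa [hp.ne'] using h6, by simpa [hp.ne'] using h7⟩
  refine ⟨X u, Y u, Z u, fun t _ => hXm u hu t, fun t ht => hYm u hu t ht,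
    fun t _ => hZm u t, ?_, ?_, fun ω => rfl, ?_⟩
  · intro t ht ω
    have h1 := (hG t ht ω).2
    simp only [G1] at h1
    change X u (t + 1) ω - X u t ω = bb u t ω + dotProduct (ss u t ω) (Mdiff P W t ω)
    linarith
  · intro t ht ω
    have h1 := (hG t ht ω).1
    simp only [G2] at h1
    have h2 := rep_decomp P W t (hpos t ht) (V u t) (hVm u hu t) ω
    have h3 : Y u t ω = cexp P W t (V u t) ω := by simp only [Y, ht, if_true]
    rw [← h3] at h2
    change Y u (t + 1) ω - Y u t ω = -ff u (t + 1) ω + dotProduct (repZ P W t (V u t) ω) (Mdiff P W t ω)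
    linarith
  · intro ω
    simp only [Y, lt_irrefl, if_false]
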